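/- arXiv:2006.05022 — 2 statements merged into one kernel-verified Lean document; each statement's English description precedes it below -/
import Mathlib

section
/- Let G_1, ..., G_n be the independent two-point random variables associated with constants A_i > 0 and B > 0. Then for every u ∈ ℝ, P̃_{2,n}(u) ≤ inf_{λ ≥ 0} E[exp(λ Σ_{i=1}^n G_i)] · exp(−λ u); that is, the Bentkus bound is no larger than the optimal Cramér–Chernoff bound computed from the worst-case two-point distribution. -/
open MeasureTheory ProbabilityTheory Real


/-- The law of the worst-case two-point random variable `G_i`:
`P(G = -a^2/b) = b^2/(a^2+b^2)`, `P(G = b) = a^2/(a^2+b^2)`. -/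
noncomputable def twoPoint (a b : ℝ) : Measure ℝ :=
  (b ^ 2 / (a ^ 2 + b ^ 2)).toNNReal • Measure.dirac (-(a ^ 2) / b)
    + (a ^ 2 / (a ^ 2 + b ^ 2)).toNNReal • Measure.dirac b

instance twoPoint_finite (a b : ℝ) : IsFiniteMeasure (twoPoint a b) := by
  unfold twoPoint; infer_instance

/-- Joint law of the independent two-point random variables `(G_1, ..., G_n)`. -/
noncomputable def gLaw (n : ℕ) (A : ℕ → ℝ) (b : ℝ) : Measure (Fin n → ℝ) :=
  Measure.pi fun i => twoPoint (A i) b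

/-- `E[((G_1 + ... + G_n − x)_+)^2]`. -/
noncomputable def gMoment2 (n : ℕ) (A : ℕ → ℝ) (b x : ℝ) : ℝ :=
  ∫ g, (max ((∑ i, g i) - x) 0) ^ 2 ∂(gLaw n A b)

/-- `P̃_{2,n}(u) = inf_{x ≤ u} E[((Σ G_i − x)_+)^2] / ((u − x)_+)^2`. -/
noncomputable def P2tilde (n : ℕ) (A : ℕ → ℝ) (b u : ℝ) : ℝ :=
  ⨅ x : {x : ℝ // x < u}, gMoment2 n A b (x : ℝ) / (u - (x : ℝ)) ^ 2

/-- `q(δ; n, 𝒜, B)`: generalized inverse of `P̃_{2,n}`. -/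
noncomputable def bentkusQ (δ : ℝ) (n : ℕ) (A : ℕ → ℝ) (b : ℝ) : ℝ :=
  if δ < ((gLaw n A b) {g | (∑ i, g i) = (n : ℝ) * b}).toReal then (n : ℝ) * b + 1
  else sInf {u : ℝ | P2tilde n A b u ≤ δ}

lemma integrable_twoPoint (a b : ℝ) (f : ℝ → ℝ) : Integrable f (twoPoint a b) := by
  unfold twoPoint
  exact ((integrable_dirac (by simp)).smul_measure_nnreal).add_measure
    ((integrable_dirac (by simp)).smul_measure_nnreal)

lemma integral_twoPoint (a b : ℝ) (f : ℝ → ℝ) :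
    ∫ t, f t ∂(twoPoint a b)
      = (b ^ 2 / (a ^ 2 + b ^ 2)).toNNReal * f (-(a ^ 2) / b)
        + (a ^ 2 / (a ^ 2 + b ^ 2)).toNNReal * f b := by
  unfold twoPoint
  rw [integral_add_measure ((integrable_dirac (by simp)).smul_measure_nnreal)
    ((integrable_dirac (by simp)).smul_measure_nnreal),
    integral_smul_nnreal_measure, integral_smul_nnreal_measure, integral_dirac, integral_dirac]
  simp [NNReal.smul_def]

lemma exp_mul_sum_eq_prod (n : ℕ) (l : ℝ) (g : Fin n → ℝ) :
    Real.exp (l * ∑ i, g i) = ∏ i, Real.exp (l * g i) := by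
  rw [Finset.mul_sum, Real.exp_sum]

lemma integrable_exp_gLaw (n : ℕ) (A : ℕ → ℝ) (b l : ℝ) :
    Integrable (fun g : Fin n → ℝ => Real.exp (l * ∑ i, g i)) (gLaw n A b) := by
  simp only [exp_mul_sum_eq_prod]
  exact Integrable.fintype_prod fun i : Fin n =>
    integrable_twoPoint (A i) b fun t => Real.exp (l * t)

lemma continuous_mgf_gLaw (n : ℕ) (A : ℕ → ℝ) (b : ℝ) :
    Continuous fun l : ℝ => ∫ g, Real.exp (l * ∑ i, g i) ∂(gLaw n A b) := by
  have h (l : ℝ) : ∫ g, Real.exp (l * ∑ i, g i) ∂(gLaw n A b)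
      = ∏ i : Fin n, ∫ t, Real.exp (l * t) ∂(twoPoint (A i) b) := by
    simp only [exp_mul_sum_eq_prod]
    exact integral_fintype_prod_eq_prod fun (_ : Fin n) (t : ℝ) => Real.exp (l * t)
  simp only [h, integral_twoPoint]
  fun_prop

/-- With `x = u - 2 / l`, the truncated square is dominated by the exponential. -/
lemma sq_posPart_div_le_exp {l : ℝ} (hl : 0 < l) (s u : ℝ) :
    (max (s - (u - 2 / l)) 0) ^ 2 / (2 / l) ^ 2 ≤ Real.exp (l * s) * Real.exp (-l * u) := by
  have hexp : Real.exp (l * s) * Real.exp (-l * u) = Real.exp (l * (s - u) / 2) ^ 2 := by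
    rw [← Real.exp_add, ← Real.exp_nat_mul]
    congr 1
    push_cast
    ring
  rw [hexp, ← div_pow]
  refine pow_le_pow_left₀ (by positivity) ?_ 2
  rw [div_le_iff₀ (by positivity)]
  refine max_le ?_ (by positivity)
  calc s - (u - 2 / l) = (l * (s - u) / 2 + 1) * (2 / l) := by field_simp; ring
    _ ≤ Real.exp (l * (s - u) / 2) * (2 / l) := by
      gcongr
      exact Real.add_one_le_exp _

lemma P2tilde_le_of_pos (n : ℕ) (A : ℕ → ℝ) (b u : ℝ) {l : ℝ} (hl : 0 < l) :
    P2tilde n A b u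
      ≤ (∫ g, Real.exp (l * ∑ i, g i) ∂(gLaw n A b)) * Real.exp (-l * u) := by
  have hbdd : BddBelow (Set.range fun x : {x : ℝ // x < u} =>
      gMoment2 n A b (x : ℝ) / (u - (x : ℝ)) ^ 2) := by
    refine ⟨0, ?_⟩
    rintro _ ⟨x, rfl⟩
    exact div_nonneg (integral_nonneg fun g => sq_nonneg _) (sq_nonneg _)
  refine (ciInf_le hbdd ⟨u - 2 / l, sub_lt_self u (by positivity)⟩).trans ?_
  simp only [sub_sub_cancel, gMoment2]
  rw [← integral_div, ← integral_mul_const]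
  refine integral_mono_of_nonneg (ae_of_all _ fun g => by positivity)
    ((integrable_exp_gLaw n A b l).mul_const _)
    (ae_of_all _ fun g => sq_posPart_div_le_exp hl _ u)

/-- The Bentkus bound is no larger than the optimal Cramér–Chernoff bound
computed from the worst-case two-point distribution: for every `u`,
`P̃_{2,n}(u) ≤ inf_{λ ≥ 0} E[exp(λ Σ G_i)]·exp(−λu)`. -/
theorem P2tilde_le_cramer_chernoff
    (n : ℕ) (hn : 1 ≤ n) (A : ℕ → ℝ) (B : ℝ)
    (hA : ∀ i, i < n → 0 < A i) (hB : 0 < B) (u : ℝ) :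
    P2tilde n A B u
      ≤ ⨅ l : {l : ℝ // 0 ≤ l},
          (∫ g, Real.exp ((l : ℝ) * ∑ i, g i) ∂(gLaw n A B)) * Real.exp (-(l : ℝ) * u) := by
  have : Nonempty {l : ℝ // 0 ≤ l} := ⟨⟨0, le_rfl⟩⟩
  refine le_ciInf fun ⟨l, hl⟩ => ?_
  have hcont : Continuous fun l : ℝ =>
      (∫ g, Real.exp (l * ∑ i, g i) ∂(gLaw n A B)) * Real.exp (-l * u) :=
    (continuous_mgf_gLaw n A B).mul (by fun_prop)
  refine ge_of_tendsto (hcont.continuousWithinAt (s := Set.Ioi l) (x := l)) ?_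
  filter_upwards [self_mem_nhdsWithin] with m hm
  exact P2tilde_le_of_pos n A B u (hl.trans_lt hm)
end

section
/- Fix t ≥ 1, B > 0, and x ∈ ℝ. For positive constants (A_1, ..., A_t), let M_t(A_1, ..., A_t) := Σ_{i=1}^t G_i where G_1, ..., G_t are the independent two-point random variables associated with A_1, ..., A_t and B. Then the map (A_1, ..., A_t) ↦ E[((M_t − x)_+)^2] is non-decreasing in each coordinate: if 0 < A_i ≤ A_i' for all i, then E[((M_t(A_1, ..., A_t) − x)_+)^2] ≤ E[((M_t(A_1', ..., A_t') − x)_+)^2]. -/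
open MeasureTheory ProbabilityTheory Real


/-- Enlarging the standard deviation of a two-point variable is a mean-preserving spread, so it
increases the expectation of every convex function. -/
theorem twoPoint_convex_mono {f : ℝ → ℝ} (hf : ConvexOn ℝ Set.univ f) {a a' b : ℝ}
    (ha : 0 < a) (hle : a ≤ a') (hb : 0 < b) :
    b ^ 2 / (a ^ 2 + b ^ 2) * f (-(a ^ 2) / b) + a ^ 2 / (a ^ 2 + b ^ 2) * f b ≤
      b ^ 2 / (a' ^ 2 + b ^ 2) * f (-(a' ^ 2) / b) + a' ^ 2 / (a' ^ 2 + b ^ 2) * f b := by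
  have hsq : a ^ 2 ≤ a' ^ 2 := by gcongr
  have hpos : 0 < a' ^ 2 + b ^ 2 := by positivity
  have hconv := hf.2 (Set.mem_univ (-(a' ^ 2) / b)) (Set.mem_univ b)
    (show 0 ≤ (a ^ 2 + b ^ 2) / (a' ^ 2 + b ^ 2) by positivity)
    (show 0 ≤ (a' ^ 2 - a ^ 2) / (a' ^ 2 + b ^ 2) from
      div_nonneg (sub_nonneg.2 hsq) hpos.le) (by field_simp; ring)
  simp only [smul_eq_mul] at hconv
  have hpoint : (a ^ 2 + b ^ 2) / (a' ^ 2 + b ^ 2) * (-(a' ^ 2) / b) +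
      (a' ^ 2 - a ^ 2) / (a' ^ 2 + b ^ 2) * b = -(a ^ 2) / b := by
    field_simp
    ring
  rw [hpoint] at hconv
  calc
    _ ≤ b ^ 2 / (a ^ 2 + b ^ 2) * ((a ^ 2 + b ^ 2) / (a' ^ 2 + b ^ 2) * f (-(a' ^ 2) / b) +
        (a' ^ 2 - a ^ 2) / (a' ^ 2 + b ^ 2) * f b) + a ^ 2 / (a ^ 2 + b ^ 2) * f b := by
      gcongr
    _ = _ := by
      field_simp
      ring

theorem gLaw_zero (A : ℕ → ℝ) (b : ℝ) : gLaw 0 A b = Measure.dirac 0 := by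
  rw [gLaw, Measure.pi_of_empty _ (0 : Fin 0 → ℝ)]

theorem measurable_finCons (n : ℕ) (y : ℝ) :
    Measurable fun g : Fin n → ℝ => (Fin.cons y g : Fin (n + 1) → ℝ) := by
  refine measurable_pi_lambda _ fun i => ?_
  refine Fin.cases ?_ (fun j => ?_) i
  · simp
  · simpa using measurable_pi_apply j

theorem gLaw_succ (n : ℕ) (A : ℕ → ℝ) (b : ℝ) :
    gLaw (n + 1) A b =
      (b ^ 2 / (A 0 ^ 2 + b ^ 2)).toNNReal •
          (gLaw n (fun i => A (i + 1)) b).map (Fin.cons (-(A 0 ^ 2) / b)) +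
        (A 0 ^ 2 / (A 0 ^ 2 + b ^ 2)).toNNReal •
          (gLaw n (fun i => A (i + 1)) b).map (Fin.cons b) := by
  have hlaw := (measurePreserving_piFinSuccAbove
    (fun i : Fin (n + 1) => twoPoint (A i) b) 0).symm.map_eq
  have : IsFiniteMeasure (gLaw n (fun i => A (i + 1)) b) := by
    unfold gLaw; infer_instance
  have hcons (y : ℝ) : Measure.map (MeasurableEquiv.piFinSuccAbove (fun _ => ℝ) 0).symm
      (Measure.map (Prod.mk y) (gLaw n (fun i => A (i + 1)) b)) =
      (gLaw n (fun i => A (i + 1)) b).map (Fin.cons y : _ → Fin (n + 1) → ℝ) := by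
    rw [Measure.map_map (MeasurableEquiv.measurable _) measurable_prodMk_left]
    congr 1
    funext g
    simp [MeasurableEquiv.piFinSuccAbove, Fin.insertNthEquiv]
  have hrest : (Measure.pi fun j : Fin n => twoPoint (A (Fin.succAbove 0 j : Fin (n + 1))) b) =
      gLaw n (fun i => A (i + 1)) b := by
    simp [gLaw]
  rw [hrest] at hlaw
  rw [gLaw, ← hlaw, Fin.val_zero, twoPoint, Measure.add_prod]
  simp only [Measure.prod_smul_left, Measure.dirac_prod]
  rw [Measure.map_add _ _ (MeasurableEquiv.measurable _)]
  simp only [Measure.map_smul, hcons]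

theorem integrable_gLaw (n : ℕ) (A : ℕ → ℝ) (b : ℝ) {f : (Fin n → ℝ) → ℝ} (hf : Measurable f) :
    Integrable f (gLaw n A b) := by
  induction n generalizing A with
  | zero =>
    rw [gLaw_zero]
    exact integrable_dirac (by simp)
  | succ n ih =>
    have hmap (y : ℝ) : Integrable f ((gLaw n (fun i => A (i + 1)) b).map (Fin.cons y)) :=
      (integrable_map_measure hf.aestronglyMeasurable (measurable_finCons n y).aemeasurable).2
        (ih _ (hf.comp (measurable_finCons n y)))
    rw [gLaw_succ]
    exact ((hmap _).smul_measure_nnreal).add_measure ((hmap _).smul_measure_nnreal)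

theorem integral_gLaw_succ (n : ℕ) (A : ℕ → ℝ) (b : ℝ) {f : ℝ → ℝ} (hf : Measurable f) :
    ∫ g, f (∑ i, g i) ∂gLaw (n + 1) A b =
      b ^ 2 / (A 0 ^ 2 + b ^ 2) *
          ∫ g, f (-(A 0 ^ 2) / b + ∑ i, g i) ∂gLaw n (fun i => A (i + 1)) b +
        A 0 ^ 2 / (A 0 ^ 2 + b ^ 2) *
          ∫ g, f (b + ∑ i, g i) ∂gLaw n (fun i => A (i + 1)) b := by
  have hF : Measurable fun g : Fin (n + 1) → ℝ => f (∑ i, g i) := by fun_prop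
  have hmap (y : ℝ) : Integrable (fun g : Fin (n + 1) → ℝ => f (∑ i, g i))
      ((gLaw n (fun i => A (i + 1)) b).map (Fin.cons y)) :=
    (integrable_map_measure hF.aestronglyMeasurable (measurable_finCons n y).aemeasurable).2
      (integrable_gLaw n _ b (hF.comp (measurable_finCons n y)))
  have hval (y : ℝ) : ∫ g, f (∑ i, g i) ∂(gLaw n (fun i => A (i + 1)) b).map
      (Fin.cons y : _ → Fin (n + 1) → ℝ) =
      ∫ g, f (y + ∑ i, g i) ∂gLaw n (fun i => A (i + 1)) b := by
    rw [integral_map (measurable_finCons n y).aemeasurable hF.aestronglyMeasurable]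
    simp [Fin.sum_univ_succ]
  rw [gLaw_succ, integral_add_measure (hmap _).smul_measure_nnreal (hmap _).smul_measure_nnreal,
    integral_smul_nnreal_measure, integral_smul_nnreal_measure, hval, hval,
    NNReal.smul_def, NNReal.smul_def, Real.coe_toNNReal _ (by positivity),
    Real.coe_toNNReal _ (by positivity), smul_eq_mul, smul_eq_mul]

theorem integral_gLaw_convex_mono (n : ℕ) {b : ℝ} (hb : 0 < b) {A A' : ℕ → ℝ}
    (hA : ∀ i, i < n → 0 < A i) (hle : ∀ i, i < n → A i ≤ A' i) {f : ℝ → ℝ}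
    (hf : ConvexOn ℝ Set.univ f) (hm : Measurable f) :
    ∫ g, f (∑ i, g i) ∂gLaw n A b ≤ ∫ g, f (∑ i, g i) ∂gLaw n A' b := by
  induction n generalizing A A' f with
  | zero => simp [gLaw_zero]
  | succ n ih =>
    have hshift (y : ℝ) : ConvexOn ℝ Set.univ fun s => f (y + s) := by
      simpa [Function.comp_def] using hf.translate_right y
    have hstep (y : ℝ) : ∫ g, f (y + ∑ i, g i) ∂gLaw n (fun i => A (i + 1)) b ≤
        ∫ g, f (y + ∑ i, g i) ∂gLaw n (fun i => A' (i + 1)) b :=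
      ih (fun i hi => hA (i + 1) (by lia)) (fun i hi => hle (i + 1) (by lia))
        (hshift y) (by fun_prop)
    have hterm (y c : ℝ) : Integrable (fun g : Fin n → ℝ => c * f (y + ∑ i, g i))
        (gLaw n (fun i => A' (i + 1)) b) := integrable_gLaw n _ b (by fun_prop)
    rw [integral_gLaw_succ n A b hm, integral_gLaw_succ n A' b hm]
    refine (add_le_add (mul_le_mul_of_nonneg_left (hstep _) (by positivity))
      (mul_le_mul_of_nonneg_left (hstep _) (by positivity))).trans ?_
    simp only [← integral_const_mul]
    rw [← integral_add (hterm _ _) (hterm _ _), ← integral_add (hterm _ _) (hterm _ _)]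
    refine integral_mono ((hterm _ _).add (hterm _ _)) ((hterm _ _).add (hterm _ _)) fun g => ?_
    have hconv : ConvexOn ℝ Set.univ fun y => f (y + ∑ i, g i) := by
      simpa [Function.comp_def] using hf.translate_left (∑ i, g i)
    exact twoPoint_convex_mono hconv (hA 0 (by lia)) (hle 0 (by lia)) hb

theorem convexOn_max_sub_sq (x : ℝ) : ConvexOn ℝ Set.univ fun s : ℝ => max (s - x) 0 ^ 2 := by
  have hsub : ConvexOn ℝ Set.univ fun s : ℝ => s - x := by
    exact (convexOn_id convex_univ).sub (concaveOn_const x convex_univ)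
  exact (hsub.sup (convexOn_const 0 convex_univ)).pow (fun _ _ => le_max_right _ _) 2

/-- Lemma 3: monotonicity of the two-point positive-part second moment
in the standard deviations. -/
theorem gMoment2_mono
    (t : ℕ) (ht : 1 ≤ t) (B : ℝ) (hB : 0 < B) (x : ℝ)
    (A A' : ℕ → ℝ) (hA : ∀ i, i < t → 0 < A i) (hle : ∀ i, i < t → A i ≤ A' i) :
    gMoment2 t A B x ≤ gMoment2 t A' B x := by
  exact integral_gLaw_convex_mono t hB hA hle (convexOn_max_sub_sq x) (by fun_prop)
end
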